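/- Let f, g : ℂ → ℂ and let Φ : ℂ → ℂ³ be complex differentiable at z₀ with derivative Φ'(z₀) = φ(z₀) = (f(z₀)(1-g(z₀)²), i·f(z₀)(1+g(z₀)²), 2f(z₀)g(z₀)). Define x(u,v) = Re Φ(u + iv). Then at z₀ = u₀ + iv₀ the partial derivatives satisfy x_u · x_u = x_v · x_v (equal lengths), where · is the real dot product on ℝ³. -/

import Mathlib

/-- The Weierstrass vector `φ(z) = (f(z)(1-g(z)²), i·f(z)(1+g(z)²), 2f(z)g(z))`. -/
def weierstrassVec (f g : ℂ) : ℂ × ℂ × ℂ :=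
  (f * (1 - g ^ 2), Complex.I * f * (1 + g ^ 2), 2 * f * g)

/-- Componentwise real part of a vector in ℂ³. -/
def reVec (w : ℂ × ℂ × ℂ) : ℝ × ℝ × ℝ := (w.1.re, w.2.1.re, w.2.2.re)

/-- The real dot product on ℝ³. -/
def dot3 (a b : ℝ × ℝ × ℝ) : ℝ := a.1 * b.1 + a.2.1 * b.2.1 + a.2.2 * b.2.2

/-- Chain rule for the componentwise real part of a complex differentiable map along a path. -/
theorem HasDerivAt.reVec_comp {Φ : ℂ → ℂ × ℂ × ℂ} {w : ℂ × ℂ × ℂ} {γ : ℝ → ℂ} {c : ℂ} {t : ℝ}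
    (hΦ : HasDerivAt Φ w (γ t)) (hγ : HasDerivAt γ c t) :
    HasDerivAt (fun s : ℝ => reVec (Φ (γ s))) (reVec (c • w)) t := by
  have h : HasDerivAt (fun s : ℝ => Φ (γ s)) (c • w) t := hΦ.scomp t hγ
  let re := Complex.reCLM
  exact (re.prodMap (re.prodMap re)).hasFDerivAt.comp_hasDerivAt t h

/-- The Weierstrass vector is isotropic, so its real and imaginary parts have equal length. -/
theorem dot3_reVec_weierstrassVec (f g : ℂ) :
    dot3 (reVec (weierstrassVec f g)) (reVec (weierstrassVec f g)) =
      dot3 (reVec (Complex.I • weierstrassVec f g))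
        (reVec (Complex.I • weierstrassVec f g)) := by
  simp [dot3, reVec, weierstrassVec, pow_two]
  ring

/-- If `Φ : ℂ → ℂ³` is complex differentiable at `z₀ = u₀ + i v₀` with derivative
the Weierstrass vector `φ(z₀)` determined by `f, g : ℂ → ℂ`, and
`x(u,v) = Re Φ(u + iv)`, then the partial derivatives of `x` at `(u₀, v₀)` satisfy
`x_u · x_u = x_v · x_v`. -/
theorem xu_sq_eq_xv_sq (f g : ℂ → ℂ) (Φ : ℂ → ℂ × ℂ × ℂ) (u₀ v₀ : ℝ)
    (hΦ : HasDerivAt Φ (weierstrassVec (f (u₀ + v₀ * Complex.I)) (g (u₀ + v₀ * Complex.I)))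
      (u₀ + v₀ * Complex.I))
    (x : ℝ × ℝ → ℝ × ℝ × ℝ)
    (hx : ∀ u v : ℝ, x (u, v) = reVec (Φ (u + v * Complex.I))) :
    dot3 (deriv (fun u : ℝ => x (u, v₀)) u₀) (deriv (fun u : ℝ => x (u, v₀)) u₀) =
      dot3 (deriv (fun v : ℝ => x (u₀, v)) v₀) (deriv (fun v : ℝ => x (u₀, v)) v₀) := by
  have hu : HasDerivAt (fun u : ℝ => (u : ℂ) + v₀ * Complex.I) 1 u₀ :=
    Complex.ofRealCLM.hasDerivAt.add_const _
  have hv : HasDerivAt (fun v : ℝ => (u₀ : ℂ) + v * Complex.I) Complex.I v₀ := by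
    simpa using (Complex.ofRealCLM.hasDerivAt.mul_const Complex.I).const_add (u₀ : ℂ)
  simp only [hx]
  rw [(HasDerivAt.reVec_comp (γ := fun u : ℝ => (u : ℂ) + v₀ * Complex.I) hΦ hu).deriv,
    (HasDerivAt.reVec_comp (γ := fun v : ℝ => (u₀ : ℂ) + v * Complex.I) hΦ hv).deriv, one_smul]
  exact dot3_reVec_weierstrassVec _ _
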